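/- arXiv:0704.2393 — 16 statements merged into one kernel-verified Lean document; each statement's English description precedes it below -/
import Mathlib

section
/- Let α₀,α₁,α₂,α₃ ∈ ℂ with α₀+α₁+2α₂+2α₃ = 1 and let (x,y) be a solution of the B₃⁽¹⁾ system with parameters (α₀,α₁,α₂,α₃) on an open set U ⊆ ℂ of times t with t ≠ 0. Then each of the following Bäcklund transformations produces a new solution: (i) if x(t) ≠ 1 on U, then (x, y − α₀/(x−1)) is a solution with parameters (−α₀, α₁, α₂+α₀, α₃); (ii) (x, y) is a solution with parameters (α₀, −α₁, α₂+α₁, α₃); (iii) if y(t) ≠ 0 on U, then (x + α₂/y, y) is a solution with parameters (α₀+α₂, α₁+α₂, −α₂, α₃+α₂); (iv) if x(t) ≠ 0 on U, then the functions s ↦ x(−s) and s ↦ y(−s) − 2α₃/x(−s) + (−s)/x(−s)², defined for s ∈ −U, form a solution in the time variable s with parameters (α₀, α₁, α₂+2α₃, −α₃); (v) if x(t) ≠ 1 on U, then the functions s ↦ x(−s)/(x(−s)−1) and s ↦ −(x(−s)−1)·((x(−s)−1)·y(−s) + α₂), defined for s ∈ −U, form a solution in s with parameters (α₁, α₀,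 α₂, α₃). -/
/-- The B₃⁽¹⁾ system: a pair of complex-valued differentiable functions `(x, y)` on an
open set `U` of times satisfying the ODEs. -/
def IsSolB3 (α₀ α₁ α₂ α₃ : ℂ) (U : Set ℂ) (x y : ℂ → ℂ) : Prop :=
  ∀ t ∈ U,
    HasDerivAt x ((-2*(x t)^3*(y t) + 2*(x t)^2*(y t) - (α₁+2*α₂)*(x t)^2
        - (t-1+2*α₃)*(x t) + t)/t) t ∧
    HasDerivAt y ((3*(x t)^2*(y t)^2 - 2*(x t)*(y t)^2 + 2*(α₁+2*α₂)*(x t)*(y t)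
        + (t-1+2*α₃)*(y t) + (α₁+α₂)*α₂)/t) t

theorem backlund_B3 (α₀ α₁ α₂ α₃ : ℂ) (hsum : α₀ + α₁ + 2*α₂ + 2*α₃ = 1)
    (U : Set ℂ) (hU : IsOpen U) (hU0 : ∀ t ∈ U, t ≠ 0)
    (x y : ℂ → ℂ) (hsol : IsSolB3 α₀ α₁ α₂ α₃ U x y) :
    ((∀ t ∈ U, x t ≠ 1) →
      IsSolB3 (-α₀) α₁ (α₂+α₀) α₃ U x (fun t => y t - α₀/(x t - 1))) ∧
    IsSolB3 α₀ (-α₁) (α₂+α₁) α₃ U x y ∧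
    ((∀ t ∈ U, y t ≠ 0) →
      IsSolB3 (α₀+α₂) (α₁+α₂) (-α₂) (α₃+α₂) U (fun t => x t + α₂/(y t)) y) ∧
    ((∀ t ∈ U, x t ≠ 0) →
      IsSolB3 α₀ α₁ (α₂+2*α₃) (-α₃) {s : ℂ | -s ∈ U}
        (fun s => x (-s))
        (fun s => y (-s) - 2*α₃/(x (-s)) + (-s)/(x (-s))^2)) ∧
    ((∀ t ∈ U, x t ≠ 1) →
      IsSolB3 α₁ α₀ α₂ α₃ {s : ℂ | -s ∈ U}
        (fun s => x (-s)/(x (-s) - 1))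
        (fun s => -(x (-s) - 1)*((x (-s) - 1)*(y (-s)) + α₂))) := by
  obtain rfl : α₀ = 1 - α₁ - 2*α₂ - 2*α₃ := by linear_combination hsum
  refine ⟨fun h1 t ht => ?_, fun t ht => ?_, fun hy t ht => ?_, fun h0 s hs => ?_,
    fun h1 s hs => ?_⟩
  · obtain ⟨hx', hy'⟩ := hsol t ht
    have ht0 := hU0 t ht
    have hx1 : x t - 1 ≠ 0 := sub_ne_zero.mpr (h1 t ht)
    constructor
    · refine HasDerivAt.congr_deriv hx' ?_
      field_simp
      ring
    · refine HasDerivAt.congr_deriv (hy'.sub ((hasDerivAt_const t _).div (hx'.sub_const 1) hx1)) ?_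
      field_simp
      ring
  · obtain ⟨hx', hy'⟩ := hsol t ht
    constructor
    · refine HasDerivAt.congr_deriv hx' ?_
      ring
    · refine HasDerivAt.congr_deriv hy' ?_
      ring
  · obtain ⟨hx', hy'⟩ := hsol t ht
    have ht0 := hU0 t ht
    have hyt := hy t ht
    constructor
    · refine HasDerivAt.congr_deriv (hx'.add ((hasDerivAt_const t α₂).div hy' hyt)) ?_
      field_simp
      ring
    · refine HasDerivAt.congr_deriv hy' ?_
      field_simp
      ring
  · obtain ⟨hx', hy'⟩ := hsol (-s) hs
    have hs0 : s ≠ 0 := neg_ne_zero.mp (hU0 (-s) hs)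
    have hx0 := h0 (-s) hs
    have hxs := hx'.scomp s (hasDerivAt_neg s)
    have hys := hy'.scomp s (hasDerivAt_neg s)
    constructor
    · refine HasDerivAt.congr_deriv hxs ?_
      simp only [smul_eq_mul]
      field_simp
      ring
    · refine HasDerivAt.congr_deriv ((hys.sub ((hasDerivAt_const s (2*α₃)).div hxs hx0)).add
        ((hasDerivAt_neg s).div (hxs.pow 2) (pow_ne_zero 2 hx0))) ?_
      simp only [smul_eq_mul, Function.comp_apply]
      field_simp
      ring
  · obtain ⟨hx', hy'⟩ := hsol (-s) hs
    have hs0 : s ≠ 0 := neg_ne_zero.mp (hU0 (-s) hs)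
    have hx1 : x (-s) - 1 ≠ 0 := sub_ne_zero.mpr (h1 (-s) hs)
    have hxs := hx'.scomp s (hasDerivAt_neg s)
    have hys := hy'.scomp s (hasDerivAt_neg s)
    constructor
    · refine HasDerivAt.congr_deriv (hxs.div (hxs.sub_const 1) hx1) ?_
      simp only [smul_eq_mul, Function.comp_apply]
      field_simp
      ring
    · refine HasDerivAt.congr_deriv ((hxs.sub_const 1).neg.mul (((hxs.sub_const 1).mul hys).add_const α₂)) ?_
      simp only [smul_eq_mul, Function.comp_apply, Pi.neg_apply]
      field_simp
      ring
end

section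
/- Let (x,y) be a solution of the B₃⁽¹⁾ system with parameters (α₀,α₁,α₂,α₃), α₀+α₁+2α₂+2α₃ = 1, on an open set U of times t ≠ 0, with x(t) ≠ 0 on U. Set β₀ = α₂+2α₃, β₁ = α₁, β₂ = α₂, β₃ = α₀. Then the functions X(T) := 1/x(−T) and Y(T) := −x(−T)·(x(−T)·y(−T) + α₂), defined for T ∈ −U, form a solution of the A₃⁽¹⁾ system in the time variable T with parameters (β₀,β₁,β₂,β₃). -/
/-- The A₃⁽¹⁾ system. -/
def IsSolA3 (β₀ β₁ β₂ β₃ : ℂ) (U : Set ℂ) (X Y : ℂ → ℂ) : Prop :=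
  ∀ T ∈ U,
    HasDerivAt X (2*(X T)^2*(Y T)/T + (X T)^2 - 2*(X T)*(Y T)/T
        - (1+(β₁+β₃)/T)*(X T) + β₁/T) T ∧
    HasDerivAt Y (-2*(X T)*(Y T)^2/T + (Y T)^2/T - 2*(X T)*(Y T)
        + (1+(β₁+β₃)/T)*(Y T) - β₂) T

theorem B3_to_A3 (α₀ α₁ α₂ α₃ : ℂ) (hsum : α₀ + α₁ + 2*α₂ + 2*α₃ = 1)
    (U : Set ℂ) (hU : IsOpen U) (hU0 : ∀ t ∈ U, t ≠ 0)
    (x y : ℂ → ℂ) (hsol : IsSolB3 α₀ α₁ α₂ α₃ U x y)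
    (hx : ∀ t ∈ U, x t ≠ 0) :
    IsSolA3 (α₂+2*α₃) α₁ α₂ α₀ {T : ℂ | -T ∈ U}
      (fun T => 1/(x (-T)))
      (fun T => -(x (-T)) * ((x (-T)) * (y (-T)) + α₂)) := by
  intro T hT
  have ht0 : T ≠ 0 := by simpa using hU0 _ hT
  have hx0 : x (-T) ≠ 0 := hx _ hT
  obtain ⟨hdx, hdy⟩ := hsol _ hT
  have hX := hdx.scomp T (hasDerivAt_neg T)
  have hY := hdy.scomp T (hasDerivAt_neg T)
  obtain rfl : α₀ = 1 - α₁ - 2 * α₂ - 2 * α₃ := by linear_combination hsum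
  constructor
  · simp only [one_div]
    refine (hX.inv hx0).congr_deriv ?_
    simp only [Function.comp_apply, smul_eq_mul]
    field_simp
    ring
  · refine (hX.neg.mul ((hX.mul hY).add_const α₂)).congr_deriv ?_
    simp only [Function.comp_apply, smul_eq_mul, Pi.neg_apply, Pi.mul_apply]
    field_simp
    ring
end

section
/- Let (x,y) be a solution of the B₃⁽¹⁾ system with parameters (α₀,α₁,α₂,α₃), α₀+α₁+2α₂+2α₃ = 1, on an open set of times t ≠ 0, such that x(t) ≠ 0 and x(t)·y(t) + α₂ ≠ 0 throughout. Then the pair of functions x̃ := −t/(x·(xy+α₂)) and ỹ := −x·(xy+α₂)·(−xy + x²y − α₀ − α₂ + α₂x)/t is a solution of the B₃⁽¹⁾ system, in the same time variable t, with parameters (α₂+2α₃, α₂, α₀, (α₁−α₀)/2). -/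
theorem backlund_phi_B3 (α₀ α₁ α₂ α₃ : ℂ) (hsum : α₀ + α₁ + 2*α₂ + 2*α₃ = 1)
    (U : Set ℂ) (hU : IsOpen U) (hU0 : ∀ t ∈ U, t ≠ 0)
    (x y : ℂ → ℂ) (hsol : IsSolB3 α₀ α₁ α₂ α₃ U x y)
    (hx : ∀ t ∈ U, x t ≠ 0) (hxy : ∀ t ∈ U, x t * y t + α₂ ≠ 0) :
    IsSolB3 (α₂+2*α₃) α₂ α₀ ((α₁-α₀)/2) U
      (fun t => -t/(x t * (x t * y t + α₂)))
      (fun t => -(x t) * (x t * y t + α₂)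
        * (-(x t)*(y t) + (x t)^2*(y t) - α₀ - α₂ + α₂*(x t)) / t) := by
  intro t ht
  obtain ⟨dx, dy⟩ := hsol t ht
  have ht0 := hU0 t ht
  have hx0 := hx t ht
  have hw0 := hxy t ht
  obtain rfl : α₁ = 1 - α₀ - 2*α₂ - 2*α₃ := by linear_combination hsum
  have dw := (dx.mul dy).add_const α₂
  have dp := dx.mul dw
  have dq := ((((dx.neg.mul dy).add ((dx.pow 2).mul dy)).sub_const α₀).sub_const α₂).add
    (dx.const_mul α₂)
  constructor
  · refine ((hasDerivAt_id t).neg.div dp (mul_ne_zero hx0 hw0)).congr_deriv ?_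
    simp only [Pi.mul_apply, Pi.neg_apply, id]
    generalize x t = X at *
    generalize y t = Y at *
    field_simp
    ring
  · refine (((dx.neg.mul dw).mul dq).div (hasDerivAt_id t) ht0).congr_deriv ?_
    simp only [Pi.mul_apply, Pi.neg_apply, Pi.add_apply, Pi.pow_apply, id]
    generalize x t = X at *
    generalize y t = Y at *
    field_simp
    ring
end

section
/- Let α₀,α₁,α₂ ∈ ℂ with α₀+2α₁+3α₂ = 1 and let (x,y) be a solution of the G₂⁽¹⁾ system with parameters (α₀,α₁,α₂) on an open set U ⊆ ℂ. Then: (i) (x,y) is a solution with parameters (−α₀, α₁+α₀, α₂); (ii) if y(t) ≠ 0 on U, then (x + α₁/y, y) is a solution with parameters (α₀+α₁, −α₁, α₂+α₁); (iii) if x(t) ≠ 0 on U, then, writing i = √−1, the functions s ↦ i·x(i s) and s ↦ −i·( y(i s) − 3α₂/x(i s) + (i s)/x(i s)² + 1/(2·x(i s)³) ), defined for s with i s ∈ U, form a solution of the G₂⁽¹⁾ system in the time variable s with parameters (α₀, α₁+3α₂, −α₂). -/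
open Complex

/-- The G₂⁽¹⁾ system. -/
def IsSolG2 (α₀ α₁ α₂ : ℂ) (U : Set ℂ) (x y : ℂ → ℂ) : Prop :=
  ∀ t ∈ U,
    HasDerivAt x (4*(x t)^3*(y t) + 2*(α₀+2*α₁)*(x t)^2 + 2*t*(x t) + 1) t ∧
    HasDerivAt y (-6*(x t)^2*(y t)^2 - 4*(α₀+2*α₁)*(x t)*(y t) - 2*t*(y t)
        - 2*α₁*(α₀+α₁)) t

/-- Time derivative of the shifted momentum `y - 3α₂/x + t/x² + 1/(2x³)` along a solution. -/
theorem IsSolG2.hasDerivAt_shift {α₀ α₁ α₂ : ℂ} (hsum : α₀ + 2*α₁ + 3*α₂ = 1)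
    {U : Set ℂ} {x y : ℂ → ℂ} (hsol : IsSolG2 α₀ α₁ α₂ U x y)
    {t w : ℂ} (ht : t ∈ U) (hx : x t ≠ 0)
    (hw : w = y t - 3*α₂/x t + t/(x t)^2 + 1/(2*(x t)^3)) :
    HasDerivAt (fun t => y t - 3*α₂/x t + t/(x t)^2 + 1/(2*(x t)^3))
      (-6*(x t)^2*w^2 - 4*(α₀+2*(α₁+3*α₂))*(x t)*w + 2*t*w
        - 2*(α₁+3*α₂)*(α₀+(α₁+3*α₂))) t := by
  obtain ⟨hdx, hdy⟩ := hsol t ht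
  have hd := ((hdy.sub ((hasDerivAt_const t (3*α₂)).div hdx hx)).add
    ((hasDerivAt_id t).div (hdx.pow 2) (pow_ne_zero 2 hx))).add
    ((hasDerivAt_const t (1 : ℂ)).div ((hdx.pow 3).const_mul 2)
      (mul_ne_zero two_ne_zero (pow_ne_zero 3 hx)))
  refine hd.congr_deriv ?_
  obtain rfl : α₀ = 1 - 2*α₁ - 3*α₂ := by linear_combination hsum
  subst hw
  simp only [id, Pi.pow_apply]
  field_simp
  ring

theorem backlund_G2 (α₀ α₁ α₂ : ℂ) (hsum : α₀ + 2*α₁ + 3*α₂ = 1)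
    (U : Set ℂ) (hU : IsOpen U)
    (x y : ℂ → ℂ) (hsol : IsSolG2 α₀ α₁ α₂ U x y) :
    IsSolG2 (-α₀) (α₁+α₀) α₂ U x y ∧
    ((∀ t ∈ U, y t ≠ 0) →
      IsSolG2 (α₀+α₁) (-α₁) (α₂+α₁) U (fun t => x t + α₁/(y t)) y) ∧
    ((∀ t ∈ U, x t ≠ 0) →
      IsSolG2 α₀ (α₁+3*α₂) (-α₂) {s : ℂ | Complex.I * s ∈ U}
        (fun s => Complex.I * x (Complex.I * s))
        (fun s => -Complex.I * (y (Complex.I * s) - 3*α₂/(x (Complex.I * s))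
          + (Complex.I * s)/(x (Complex.I * s))^2
          + 1/(2*(x (Complex.I * s))^3)))) := by
  refine ⟨fun t ht => ?_, fun hy t ht => ?_, fun hx s hs => ?_⟩
  · obtain ⟨hdx, hdy⟩ := hsol t ht
    exact ⟨hdx.congr_deriv (by ring), hdy.congr_deriv (by ring)⟩
  · obtain ⟨hdx, hdy⟩ := hsol t ht
    have hyt := hy t ht
    refine ⟨(hdx.add ((hasDerivAt_const t α₁).div hdy hyt)).congr_deriv ?_,
      hdy.congr_deriv ?_⟩
    · field_simp
      ring
    · field_simp
      ring
  · have hs' : I * s ∈ U := hs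
    have hxt := hx _ hs'
    have hrot : HasDerivAt (fun s : ℂ => I * s) I s := by
      simpa using (hasDerivAt_id s).const_mul I
    have hdx := (hsol _ hs').1
    obtain ⟨w, hw⟩ : ∃ w, w = y (I * s) - 3*α₂/x (I * s) + I * s/(x (I * s))^2
      + 1/(2*(x (I * s))^3) := ⟨_, rfl⟩
    have hdw := hsol.hasDerivAt_shift hsum hs' hxt hw
    refine ⟨((hdx.comp s hrot).const_mul I).congr_deriv ?_,
      ((hdw.comp s hrot).const_mul (-I)).congr_deriv ?_⟩
    · have hy : y (I * s) = w + 3*α₂/x (I * s) - I * s/(x (I * s))^2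
          - 1/(2*(x (I * s))^3) := by
        rw [hw]; ring
      simp only [← hw]
      rw [hy]
      obtain rfl : α₀ = 1 - 2*α₁ - 3*α₂ := by linear_combination hsum
      generalize x (I * s) = a at hxt ⊢
      field_simp
      ring_nf
      simp only [I_sq, I_pow_three, I_pow_four]
      ring
    · simp only [← hw]
      generalize x (I * s) = a
      ring_nf
      simp only [I_sq, I_pow_three, I_pow_four]
      ring
end

section
/- Let A₀,A₁,A₂ ∈ ℂ with A₀+2A₁+3A₂ = 1, and fix (X,Y,T) ∈ ℂ³. For ε ≠ 0 set x = (ε−X)/ε, y = −εY, t = (−1−2εT)/(2ε²), and let (f,g) be the right-hand sides of the B₃⁽¹⁾ system at (x,y,t) with parameters α₀ = −1/(2ε²), α₁ = A₀, α₂ = A₁, α₃ = (1+6A₂ε²)/(4ε²). Define F_ε(X,Y,T) := f and G_ε(X,Y,T) := g/ε² (these are the chain-rule derivatives dX/dT, dY/dT of the inverse substitution X = ε(1−x), Y = −y/ε along the B₃⁽¹⁾ flow, since dt/dT = −1/ε). Then, as ε → 0 through nonzero values, F_ε(X,Y,T) → 4X³Y + 2(A₀+2A₁)X² + 2TX + 1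 and G_ε(X,Y,T) → −6X²Y² − 4(A₀+2A₁)XY − 2TY − 2A₁(A₀+A₁), i.e. the transformed system tends to the G₂⁽¹⁾ system with parameters (A₀,A₁,A₂). -/
open Filter Topology

/-- Right-hand side of the first B₃⁽¹⁾ equation. -/
noncomputable def B3rhs1 (α₁ α₂ α₃ x y t : ℂ) : ℂ :=
  (-2*x^3*y + 2*x^2*y - (α₁+2*α₂)*x^2 - (t-1+2*α₃)*x + t)/t

/-- Right-hand side of the second B₃⁽¹⁾ equation. -/
noncomputable def B3rhs2 (α₁ α₂ α₃ x y t : ℂ) : ℂ :=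
  (3*x^2*y^2 - 2*x*y^2 + 2*(α₁+2*α₂)*x*y + (t-1+2*α₃)*y + (α₁+α₂)*α₂)/t

/-- The first B₃⁽¹⁾ right-hand side in the rescaled variables, with the poles at `ε = 0` cancelled. -/
theorem B3rhs1_rescaled {A₀ A₁ A₂ : ℂ} (hsum : A₀ + 2*A₁ + 3*A₂ = 1) (X Y T : ℂ) {ε : ℂ}
    (hε : ε ≠ 0) (hT : 1 + 2*ε*T ≠ 0) :
    B3rhs1 A₀ A₁ ((1+6*A₂*ε^2)/(4*ε^2)) ((ε - X)/ε) (-ε*Y) ((-1 - 2*ε*T)/(2*ε^2)) =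
      (4*X*Y*(ε-X)^2 + 2*(A₀+2*A₁)*(ε-X)^2 - 2*(T+(A₀+2*A₁)*ε)*(ε-X)) / (1 + 2*ε*T) + 1 := by
  have hT' : -1 - 2*ε*T ≠ 0 := fun h => hT (by linear_combination -h)
  obtain rfl : A₀ = 1 - 2*A₁ - 3*A₂ := by linear_combination hsum
  rw [B3rhs1, div_add_one hT, div_eq_div_iff (div_ne_zero hT' (mul_ne_zero two_ne_zero (pow_ne_zero 2 hε))) hT]
  field_simp
  ring

/-- The second B₃⁽¹⁾ right-hand side in the rescaled variables, with the poles at `ε = 0` cancelled. -/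
theorem B3rhs2_rescaled {A₀ A₁ A₂ : ℂ} (hsum : A₀ + 2*A₁ + 3*A₂ = 1) (X Y T : ℂ) {ε : ℂ}
    (hε : ε ≠ 0) (hT : 1 + 2*ε*T ≠ 0) :
    B3rhs2 A₀ A₁ ((1+6*A₂*ε^2)/(4*ε^2)) ((ε - X)/ε) (-ε*Y) ((-1 - 2*ε*T)/(2*ε^2)) / ε^2 =
      -2 * (Y^2*(ε-X)*(ε-3*X) - 2*(A₀+2*A₁)*(ε-X)*Y + (T+(A₀+2*A₁)*ε)*Y + (A₀+A₁)*A₁) /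
        (1 + 2*ε*T) := by
  have hT' : -1 - 2*ε*T ≠ 0 := fun h => hT (by linear_combination -h)
  obtain rfl : A₀ = 1 - 2*A₁ - 3*A₂ := by linear_combination hsum
  rw [B3rhs2, div_div, div_eq_div_iff (mul_ne_zero (div_ne_zero hT' (mul_ne_zero two_ne_zero (pow_ne_zero 2 hε))) (pow_ne_zero 2 hε)) hT]
  field_simp
  ring

theorem degeneration_B3_to_G2 (A₀ A₁ A₂ : ℂ) (hsum : A₀ + 2*A₁ + 3*A₂ = 1)
    (X Y T : ℂ) :
    Tendsto (fun ε : ℂ =>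
        let x := (ε - X)/ε
        let y := -ε*Y
        let t := (-1 - 2*ε*T)/(2*ε^2)
        B3rhs1 A₀ A₁ ((1+6*A₂*ε^2)/(4*ε^2)) x y t)
      (𝓝[≠] (0:ℂ))
      (𝓝 (4*X^3*Y + 2*(A₀+2*A₁)*X^2 + 2*T*X + 1)) ∧
    Tendsto (fun ε : ℂ =>
        let x := (ε - X)/ε
        let y := -ε*Y
        let t := (-1 - 2*ε*T)/(2*ε^2)
        B3rhs2 A₀ A₁ ((1+6*A₂*ε^2)/(4*ε^2)) x y t / ε^2)
      (𝓝[≠] (0:ℂ))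
      (𝓝 (-6*X^2*Y^2 - 4*(A₀+2*A₁)*X*Y - 2*T*Y - 2*A₁*(A₀+A₁))) := by
  have hne : ∀ᶠ ε : ℂ in 𝓝[≠] 0, ε ≠ 0 := eventually_mem_nhdsWithin
  have hcont : ContinuousAt (fun ε : ℂ => 1 + 2*ε*T) 0 := by fun_prop
  have hT : ∀ᶠ ε : ℂ in 𝓝[≠] 0, 1 + 2*ε*T ≠ 0 :=
    (hcont.eventually_ne (by simp)).filter_mono nhdsWithin_le_nhds
  constructor
  · have hlim : ContinuousAt (fun ε : ℂ => (4*X*Y*(ε-X)^2 + 2*(A₀+2*A₁)*(ε-X)^2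
        - 2*(T+(A₀+2*A₁)*ε)*(ε-X)) / (1 + 2*ε*T) + 1) 0 :=
      (ContinuousAt.div (by fun_prop) hcont (by simp)).add continuousAt_const
    refine Tendsto.congr' ?_ ((hlim.tendsto.mono_left nhdsWithin_le_nhds).mono_right (le_of_eq ?_))
    · filter_upwards [hne, hT] with ε hε hεT using (B3rhs1_rescaled hsum X Y T hε hεT).symm
    · congr 1
      ring
  · have hlim : ContinuousAt (fun ε : ℂ => -2 * (Y^2*(ε-X)*(ε-3*X) - 2*(A₀+2*A₁)*(ε-X)*Y
        + (T+(A₀+2*A₁)*ε)*Y + (A₀+A₁)*A₁) / (1 + 2*ε*T)) 0 :=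
      ContinuousAt.div (by fun_prop) hcont (by simp)
    refine Tendsto.congr' ?_ ((hlim.tendsto.mono_left nhdsWithin_le_nhds).mono_right (le_of_eq ?_))
    · filter_upwards [hne, hT] with ε hε hεT using (B3rhs2_rescaled hsum X Y T hε hεT).symm
    · congr 1
      ring
end

section
/- Let (x,y) be a solution of the G₂⁽¹⁾ system with parameters (α₀,α₁,α₂), α₀+2α₁+3α₂ = 1, on an open set where x(t) ≠ 0. Set β₀ = α₁+3α₂, β₁ = α₀, β₂ = α₁. Then the functions X := 1/x and Y := −x·(xy+α₁) form a solution, in the same time variable T = t, of the A₂⁽¹⁾ system with parameters (β₀,β₁,β₂). -/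
/-- The A₂⁽¹⁾ system. -/
def IsSolA2 (β₀ β₁ β₂ : ℂ) (U : Set ℂ) (X Y : ℂ → ℂ) : Prop :=
  ∀ T ∈ U,
    HasDerivAt X (-(X T)^2 + 4*(X T)*(Y T) - 2*T*(X T) - 2*β₁) T ∧
    HasDerivAt Y (-2*(Y T)^2 + 2*(X T)*(Y T) + 2*T*(Y T) + β₂) T

theorem G2_to_A2 (α₀ α₁ α₂ : ℂ) (hsum : α₀ + 2*α₁ + 3*α₂ = 1)
    (U : Set ℂ) (hU : IsOpen U)
    (x y : ℂ → ℂ) (hsol : IsSolG2 α₀ α₁ α₂ U x y)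
    (hx : ∀ t ∈ U, x t ≠ 0) :
    IsSolA2 (α₁+3*α₂) α₀ α₁ U
      (fun t => 1/(x t))
      (fun t => -(x t) * (x t * y t + α₁)) := by
  intro t ht
  obtain ⟨hdx, hdy⟩ := hsol t ht
  have hxt := hx t ht
  constructor
  · simp only [one_div]
    refine (hdx.fun_inv hxt).congr_deriv ?_
    field_simp
    ring
  · refine (hdx.fun_neg.fun_mul ((hdx.fun_mul hdy).add_const α₁)).congr_deriv ?_
    field_simp
    ring
end

section
/- Let (x,y) be a solution of the G₂⁽¹⁾ system with parameters (α₀,α₁,α₂), α₀+2α₁+3α₂ = 1, on an open set where x(t) ≠ 0 and x(t)·y(t)+α₁ ≠ 0. Then the pair of functions x̃ := 1/(2x·(xy+α₁)) and ỹ := −2x·(xy+α₁)·( xy + 2tx²y + 2x⁴y² + 4α₁x³y + 2α₁²x² + 2α₁tx + 2α₁ + 3α₂ ) is a solution of the G₂⁽¹⁾ system, in the same time variable t, with parameters (α₁, α₁+3α₂, (α₀−α₁−3α₂)/3). -/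
theorem backlund_phi_G2 (α₀ α₁ α₂ : ℂ) (hsum : α₀ + 2*α₁ + 3*α₂ = 1)
    (U : Set ℂ) (hU : IsOpen U)
    (x y : ℂ → ℂ) (hsol : IsSolG2 α₀ α₁ α₂ U x y)
    (hx : ∀ t ∈ U, x t ≠ 0) (hxy : ∀ t ∈ U, x t * y t + α₁ ≠ 0) :
    IsSolG2 α₁ (α₁+3*α₂) ((α₀-α₁-3*α₂)/3) U
      (fun t => 1/(2*(x t)*(x t * y t + α₁)))
      (fun t => -2*(x t)*(x t * y t + α₁)
        * ((x t)*(y t) + 2*t*(x t)^2*(y t) + 2*(x t)^4*(y t)^2 + 4*α₁*(x t)^3*(y t)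
          + 2*α₁^2*(x t)^2 + 2*α₁*t*(x t) + 2*α₁ + 3*α₂)) := by
  intro t ht
  obtain ⟨hx', hy'⟩ := hsol t ht
  have hx0 := hx t ht
  have hxy0 := hxy t ht
  obtain rfl : α₀ = 1 - 2*α₁ - 3*α₂ := by linear_combination hsum
  have hid := hasDerivAt_id' t
  have hfactor := (hx'.const_mul 2).mul ((hx'.mul hy').add_const α₁)
  have hneg := (hx'.const_mul (-2)).mul ((hx'.mul hy').add_const α₁)
  have hcofactor := (((((((hx'.mul hy').add (((hid.const_mul 2).mul (hx'.pow 2)).mul hy')).add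
    (((hx'.pow 4).const_mul 2).mul (hy'.pow 2))).add
    (((hx'.pow 3).const_mul (4*α₁)).mul hy')).add
    ((hx'.pow 2).const_mul (2*α₁^2))).add
    ((hid.const_mul (2*α₁)).mul hx')).add_const (2*α₁)).add_const (3*α₂)
  constructor
  · refine ((hasDerivAt_const t (1 : ℂ)).div hfactor ?_).congr_deriv ?_
    · simp [hx0, hxy0]
    · simp only [Pi.mul_apply]
      field_simp
      ring
  · refine (hneg.mul hcofactor).congr_deriv ?_
    simp only [Pi.mul_apply, Pi.add_apply, Pi.pow_apply]
    field_simp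
    ring
end

section
/- Let α₀,α₁,α₂ ∈ ℂ with α₀+α₁+α₂ = 1/2 and let (x,y) be a solution of the D₃⁽²⁾ system with parameters (α₀,α₁,α₂) on an open set U of times t ≠ 0. Then: (i) if x(t) ≠ 0 on U, the functions s ↦ −x(−s) and s ↦ −y(−s) + 2α₀/x(−s) − 1/x(−s)², defined for s ∈ −U, form a solution in the time variable s with parameters (−α₀, α₁+2α₀, α₂); (ii) if y(t) ≠ 0 on U, then (x + α₁/y, y) is a solution (same t) with parameters (α₀+α₁, −α₁, α₂+α₁); (iii) the functions s ↦ x(−s) and s ↦ y(−s) + s, defined for s ∈ −U, form a solution in s with parameters (α₀, α₁+2α₂, −α₂); (iv) if x(t) ≠ 0 on U, then (1/(tx), −tx·(yx+α₁)) is a solution (same t) with parameters (α₂, α₁, α₀). -/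
/-- The D₃⁽²⁾ system. -/
def IsSolD32 (α₀ α₁ α₂ : ℂ) (U : Set ℂ) (x y : ℂ → ℂ) : Prop :=
  ∀ t ∈ U,
    HasDerivAt x (2*(x t)^2*(y t)/t - (x t)^2 - 2*α₀*(x t)/t + 1/t) t ∧
    HasDerivAt y (-2*(x t)*(y t)^2/t + 2*(x t)*(y t) + 2*α₀*(y t)/t + α₁) t

theorem HasDerivAt.comp_neg {f : ℂ → ℂ} {f' s : ℂ} (hf : HasDerivAt f f' (-s)) :
    HasDerivAt (fun r => f (-r)) (-f') s := by
  simpa [Function.comp_def] using hf.scomp s (hasDerivAt_neg s)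

theorem backlund_D32 (α₀ α₁ α₂ : ℂ) (hsum : α₀ + α₁ + α₂ = 1/2)
    (U : Set ℂ) (hU : IsOpen U) (hU0 : ∀ t ∈ U, t ≠ 0)
    (x y : ℂ → ℂ) (hsol : IsSolD32 α₀ α₁ α₂ U x y) :
    ((∀ t ∈ U, x t ≠ 0) →
      IsSolD32 (-α₀) (α₁+2*α₀) α₂ {s : ℂ | -s ∈ U}
        (fun s => -x (-s))
        (fun s => -y (-s) + 2*α₀/(x (-s)) - 1/(x (-s))^2)) ∧
    ((∀ t ∈ U, y t ≠ 0) →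
      IsSolD32 (α₀+α₁) (-α₁) (α₂+α₁) U (fun t => x t + α₁/(y t)) y) ∧
    IsSolD32 α₀ (α₁+2*α₂) (-α₂) {s : ℂ | -s ∈ U}
      (fun s => x (-s)) (fun s => y (-s) + s) ∧
    ((∀ t ∈ U, x t ≠ 0) →
      IsSolD32 α₂ α₁ α₀ U
        (fun t => 1/(t * x t))
        (fun t => -t * (x t) * (y t * x t + α₁))) := by
  obtain rfl : α₂ = 1/2 - α₀ - α₁ := by linear_combination hsum
  refine ⟨fun hx s hs => ?_, fun hy t ht => ?_, fun s hs => ?_, fun hx t ht => ?_⟩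
  · obtain ⟨hdx, hdy⟩ := hsol (-s) hs
    have hs0 : s ≠ 0 := neg_ne_zero.mp (hU0 (-s) hs)
    have hxs : x (-s) ≠ 0 := hx (-s) hs
    have hdx' := hdx.comp_neg
    have hdy' := hdy.comp_neg
    refine ⟨hdx'.fun_neg.congr_deriv ?_,
      ((hdy'.fun_neg.fun_add ((hasDerivAt_const s (2 * α₀)).fun_div hdx' hxs)).fun_sub
        ((hasDerivAt_const s (1 : ℂ)).fun_div (hdx'.fun_pow 2)
          (pow_ne_zero 2 hxs))).congr_deriv ?_⟩
    · field_simp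
      ring
    · field_simp
      ring
  · obtain ⟨hdx, hdy⟩ := hsol t ht
    have ht0 : t ≠ 0 := hU0 t ht
    have hyt : y t ≠ 0 := hy t ht
    refine ⟨(hdx.fun_add ((hasDerivAt_const t α₁).fun_div hdy hyt)).congr_deriv ?_,
      hdy.congr_deriv ?_⟩
    · field_simp
      ring
    · field_simp
      ring
  · obtain ⟨hdx, hdy⟩ := hsol (-s) hs
    have hs0 : s ≠ 0 := neg_ne_zero.mp (hU0 (-s) hs)
    refine ⟨hdx.comp_neg.congr_deriv ?_,
      (hdy.comp_neg.fun_add (hasDerivAt_id' s)).congr_deriv ?_⟩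
    · field_simp
      ring
    · field_simp
      ring
  · obtain ⟨hdx, hdy⟩ := hsol t ht
    have ht0 : t ≠ 0 := hU0 t ht
    have hxt : x t ≠ 0 := hx t ht
    refine ⟨((hasDerivAt_const t (1 : ℂ)).fun_div ((hasDerivAt_id' t).fun_mul hdx)
        (mul_ne_zero ht0 hxt)).congr_deriv ?_,
      (((hasDerivAt_id' t).fun_neg.fun_mul hdx).fun_mul
        ((hdy.fun_mul hdx).add_const α₁)).congr_deriv ?_⟩
    · field_simp
      ring
    · field_simp
      ring
end

section
/- Let A₀,A₁,A₂ ∈ ℂ with A₀+A₁+A₂ = 1/2, and fix (X,Y,T) with T ≠ 0. For ε ≠ 0 with εT ≠ 0 and 1+εTX ≠ 0, set x = εTX/(1+εTX), y = (1+εTX)·(εTXY + Y + A₁εT)/(εT), t = εT, and let (f,g) be the right-hand sides of the B₃⁽¹⁾ system at (x,y,t) with parameters α₀ = −(1−2A₂ε)/ε, α₁ = 1/ε, α₂ = A₁, α₃ = A₀. Define F_ε(X,Y,T) := f/(T(1−x)²) − X/T and G_ε(X,Y,T) := ε²T·[ (A₁ − 2(1−x)y)·f + (1−x)²·g ] + Y/T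 (these are the chain-rule derivatives dX/dT, dY/dT of the inverse substitution X = x/(εT(1−x)), Y = εT(1−x)·((1−x)y − A₁) along the B₃⁽¹⁾ flow, since dt/dT = ε). Then, as ε → 0 through nonzero values, F_ε(X,Y,T) → 2X²Y/T − X² − 2A₀X/T + 1/T and G_ε(X,Y,T) → −2XY²/T + 2XY + 2A₀Y/T + A₁, i.e. the transformed system tends to the D₃⁽²⁾ system with parameters (A₀,A₁,A₂). -/
open Filter Topology

/-- The `X`-component of the B₃⁽¹⁾ vector field in the rescaled chart, with the poles in `ε`
cancelled. -/
theorem chart_rhs1_eq (A₀ A₁ X Y T ε : ℂ) (hε : ε ≠ 0) (hT : T ≠ 0)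
    (hu : 1 + ε*T*X ≠ 0) :
    B3rhs1 (1/ε) A₁ A₀ (ε*T*X/(1 + ε*T*X))
        ((1 + ε*T*X)*(ε*T*X*Y + Y + A₁*ε*T)/(ε*T)) (ε*T)
        / (T*(1 - ε*T*X/(1 + ε*T*X))^2) - X/T
      = (2*X^2*(1 + ε*T*X)*Y - T*X^2
        - (ε*T - 1 + 2*A₀)*X*(1 + ε*T*X) + (1 + ε*T*X)^2)/T - X/T := by
  have hx : 1 - ε*T*X/(1 + ε*T*X) = 1/(1 + ε*T*X) := by
    field_simp
    ring
  rw [hx]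
  unfold B3rhs1
  field_simp
  ring

/-- The `Y`-component of the B₃⁽¹⁾ vector field in the rescaled chart, with the poles in `ε`
cancelled. -/
theorem chart_rhs2_eq (A₀ A₁ X Y T ε : ℂ) (hε : ε ≠ 0) (hT : T ≠ 0)
    (hu : 1 + ε*T*X ≠ 0) :
    ε^2*T*((A₁ - 2*(1 - ε*T*X/(1 + ε*T*X))
            *((1 + ε*T*X)*(ε*T*X*Y + Y + A₁*ε*T)/(ε*T)))
          * B3rhs1 (1/ε) A₁ A₀ (ε*T*X/(1 + ε*T*X))
            ((1 + ε*T*X)*(ε*T*X*Y + Y + A₁*ε*T)/(ε*T)) (ε*T)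
        + (1 - ε*T*X/(1 + ε*T*X))^2
          * B3rhs2 (1/ε) A₁ A₀ (ε*T*X/(1 + ε*T*X))
            ((1 + ε*T*X)*(ε*T*X*Y + Y + A₁*ε*T)/(ε*T)) (ε*T)) + Y/T
      = (-(ε*(2*(1 + ε*T*X)*Y + A₁*ε*T)*(2*X^2*(1 + ε*T*X)*Y - T*X^2
            - (ε*T - 1 + 2*A₀)*X*(1 + ε*T*X) + (1 + ε*T*X)^2))
          + 3*ε*X^2*(ε*T*X*Y + Y + A₁*ε*T)^2
          - 2*X*(1 + ε*T*X)*(ε*T*X*Y + Y + A₁*ε*T)^2/T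
          + 2*(1 + 2*A₁*ε)*X*(ε*T*X*Y + Y + A₁*ε*T)
          + (ε*T - 1 + 2*A₀)*(ε*T*X*Y + Y + A₁*ε*T)*(1 + ε*T*X)/T
          + (1 + ε*A₁)*A₁)/(1 + ε*T*X)^2 + Y/T := by
  have hx : 1 - ε*T*X/(1 + ε*T*X) = 1/(1 + ε*T*X) := by
    field_simp
    ring
  rw [hx]
  unfold B3rhs1 B3rhs2
  field_simp
  ring

theorem degeneration_B3_to_D32 (A₀ A₁ A₂ : ℂ) (hsum : A₀ + A₁ + A₂ = 1/2)
    (X Y T : ℂ) (hT : T ≠ 0) :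
    Tendsto (fun ε : ℂ =>
        let x := ε*T*X/(1 + ε*T*X)
        let y := (1 + ε*T*X)*(ε*T*X*Y + Y + A₁*ε*T)/(ε*T)
        let t := ε*T
        let f := B3rhs1 (1/ε) A₁ A₀ x y t
        f/(T*(1-x)^2) - X/T)
      (𝓝[{ε : ℂ | ε ≠ 0 ∧ ε*T ≠ 0 ∧ 1 + ε*T*X ≠ 0}] (0:ℂ))
      (𝓝 (2*X^2*Y/T - X^2 - 2*A₀*X/T + 1/T)) ∧
    Tendsto (fun ε : ℂ =>
        let x := ε*T*X/(1 + ε*T*X)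
        let y := (1 + ε*T*X)*(ε*T*X*Y + Y + A₁*ε*T)/(ε*T)
        let t := ε*T
        let f := B3rhs1 (1/ε) A₁ A₀ x y t
        let g := B3rhs2 (1/ε) A₁ A₀ x y t
        ε^2*T*((A₁ - 2*(1-x)*y)*f + (1-x)^2*g) + Y/T)
      (𝓝[{ε : ℂ | ε ≠ 0 ∧ ε*T ≠ 0 ∧ 1 + ε*T*X ≠ 0}] (0:ℂ))
      (𝓝 (-2*X*Y^2/T + 2*X*Y + 2*A₀*Y/T + A₁)) := by
  constructor
  · have hF : ContinuousAt (fun ε : ℂ => (2*X^2*(1 + ε*T*X)*Y - T*X^2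
        - (ε*T - 1 + 2*A₀)*X*(1 + ε*T*X) + (1 + ε*T*X)^2)/T - X/T) 0 := by fun_prop
    have hlim := hF.tendsto.mono_left (nhdsWithin_le_nhds
      (s := {ε : ℂ | ε ≠ 0 ∧ ε*T ≠ 0 ∧ 1 + ε*T*X ≠ 0}))
    convert hlim.congr' ?_ using 1
    · congr 1
      field_simp
      ring
    · filter_upwards [self_mem_nhdsWithin] with ε hε
      exact (chart_rhs1_eq A₀ A₁ X Y T ε hε.1 hT hε.2.2).symm
  · have hG : ContinuousAt (fun ε : ℂ =>
        (-(ε*(2*(1 + ε*T*X)*Y + A₁*ε*T)*(2*X^2*(1 + ε*T*X)*Y - T*X^2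
            - (ε*T - 1 + 2*A₀)*X*(1 + ε*T*X) + (1 + ε*T*X)^2))
          + 3*ε*X^2*(ε*T*X*Y + Y + A₁*ε*T)^2
          - 2*X*(1 + ε*T*X)*(ε*T*X*Y + Y + A₁*ε*T)^2/T
          + 2*(1 + 2*A₁*ε)*X*(ε*T*X*Y + Y + A₁*ε*T)
          + (ε*T - 1 + 2*A₀)*(ε*T*X*Y + Y + A₁*ε*T)*(1 + ε*T*X)/T
          + (1 + ε*A₁)*A₁)/(1 + ε*T*X)^2 + Y/T) 0 := by
      refine ContinuousAt.add (ContinuousAt.div (by fun_prop) (by fun_prop) (by simp)) ?_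
      fun_prop
    have hlim := hG.tendsto.mono_left (nhdsWithin_le_nhds
      (s := {ε : ℂ | ε ≠ 0 ∧ ε*T ≠ 0 ∧ 1 + ε*T*X ≠ 0}))
    convert hlim.congr' ?_ using 1
    · congr 1
      field_simp
      ring
    · filter_upwards [self_mem_nhdsWithin] with ε hε
      exact (chart_rhs2_eq A₀ A₁ X Y T ε hε.1 hT hε.2.2).symm
end

section
/- Let (x,y) be a solution of the D₃⁽²⁾ system with parameters (α₀,α₁,α₂), α₀+α₁+α₂ = 1/2, on an open set of times t ≠ 0 where x(t) ≠ 0. Set β₀ = α₁, β₁ = α₂, β₂ = 2α₀+α₁. Then the functions X := 1/x and Y := −x·(xy+α₁) form a solution, in the same time variable T = t, of the C₂⁽¹⁾ system with parameters (β₀,β₁,β₂). -/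
/-- The C₂⁽¹⁾ system. -/
def IsSolC2 (β₀ β₁ β₂ : ℂ) (U : Set ℂ) (X Y : ℂ → ℂ) : Prop :=
  ∀ T ∈ U,
    HasDerivAt X (2*(X T)^2*(Y T)/T - (X T)^2/T + (β₀+β₂)*(X T)/T + 1) T ∧
    HasDerivAt Y (-2*(X T)*(Y T)^2/T + 2*(X T)*(Y T)/T - (β₀+β₂)*(Y T)/T + β₀/T) T

theorem D32_to_C2 (α₀ α₁ α₂ : ℂ) (hsum : α₀ + α₁ + α₂ = 1/2)
    (U : Set ℂ) (hU : IsOpen U) (hU0 : ∀ t ∈ U, t ≠ 0)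
    (x y : ℂ → ℂ) (hsol : IsSolD32 α₀ α₁ α₂ U x y)
    (hx : ∀ t ∈ U, x t ≠ 0) :
    IsSolC2 α₁ α₂ (2*α₀+α₁) U
      (fun t => 1/(x t))
      (fun t => -(x t) * (x t * y t + α₁)) := by
  intro t ht
  obtain ⟨hx', hy'⟩ := hsol t ht
  have ht0 := hU0 t ht
  have hx0 := hx t ht
  constructor
  · simp only [one_div]
    refine (hx'.fun_inv hx0).congr_deriv ?_
    field_simp
    ring
  · refine (hx'.fun_neg.fun_mul ((hx'.fun_mul hy').add_const α₁)).congr_deriv ?_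
    field_simp
    ring
end

section
/- Let α₀,α₁ ∈ ℂ with 2α₀+α₁ = 1 and let (x,y) be a solution of the A₂⁽²⁾ system with parameters (α₀,α₁) on an open set U ⊆ ℂ. Then: (i) if y(t) ≠ 0 on U, the pair (x + α₀/y, y) is a solution with parameters (−α₀, α₁+4α₀); (ii) if x(t) ≠ 0 on U, the pair (−x, −y + α₁/x − t/x² − 2/x⁴) is a solution, in the same time variable t, with parameters (α₀+α₁, −α₁). -/
/-- The A₂⁽²⁾ system. -/
def IsSolA22 (α₀ α₁ : ℂ) (U : Set ℂ) (x y : ℂ → ℂ) : Prop :=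
  ∀ t ∈ U,
    HasDerivAt x ((x t)^4*(y t) + α₀*(x t)^3 + (t/2)*(x t)^2 + 1) t ∧
    HasDerivAt y (-2*(x t)^3*(y t)^2 - 3*α₀*(x t)^2*(y t) - t*(x t)*(y t)
        - α₀^2*(x t) - α₀*t/2) t

theorem backlund_A22 (α₀ α₁ : ℂ) (hsum : 2*α₀ + α₁ = 1)
    (U : Set ℂ) (hU : IsOpen U)
    (x y : ℂ → ℂ) (hsol : IsSolA22 α₀ α₁ U x y) :
    ((∀ t ∈ U, y t ≠ 0) →
      IsSolA22 (-α₀) (α₁+4*α₀) U (fun t => x t + α₀/(y t)) y) ∧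
    ((∀ t ∈ U, x t ≠ 0) →
      IsSolA22 (α₀+α₁) (-α₁) U
        (fun t => -x t)
        (fun t => -y t + α₁/(x t) - t/(x t)^2 - 2/(x t)^4)) := by
  obtain rfl : α₁ = 1 - 2 * α₀ := by linear_combination hsum
  refine ⟨fun hy t ht => ?_, fun hx t ht => ?_⟩
  · obtain ⟨hx', hy'⟩ := hsol t ht
    have hyt := hy t ht
    constructor
    · refine (hx'.add ((hasDerivAt_const t α₀).div hy' hyt)).congr_deriv ?_
      field_simp
      ring
    · refine hy'.congr_deriv ?_
      field_simp
      ring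
  · obtain ⟨hx', hy'⟩ := hsol t ht
    have hxt := hx t ht
    constructor
    · refine hx'.neg.congr_deriv ?_
      field_simp
      ring
    · refine (((hy'.neg.add ((hasDerivAt_const t (1 - 2 * α₀)).div hx' hxt)).sub
        ((hasDerivAt_id t).div (hx'.pow 2) (pow_ne_zero 2 hxt))).sub
        ((hasDerivAt_const t (2 : ℂ)).div (hx'.pow 4) (pow_ne_zero 4 hxt))).congr_deriv ?_
      simp only [Pi.pow_apply, id_eq]
      field_simp
      ring
end

section
/- Let A₀,A₁ ∈ ℂ with 2A₀+A₁ = 1, and fix (X,Y,T) ∈ ℂ³. For ε ≠ 0 with 2ε²+X ≠ 0 and √2·ε³ − x ≠ 0 (where x is as below), set x = √2·ε³·X/(2ε²+X), y = (X+2ε²)·(XY + 2ε²Y + A₀)/(2√2·ε⁵), t = −(1−ε⁴T)/(√2·ε³), and let (f,g) be the right-hand sides of the G₂⁽¹⁾ system at (x,y,t) with parameters α₀ = 1/(4ε⁶), α₁ = A₀, α₂ = (4A₁ε⁶−1)/(12ε⁶). Define F_ε(X,Y,T) := (ε/√2)·(∂X̃/∂x)·f and G_ε(X,Y,T) := (ε/√2)·(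 (∂Ỹ/∂x)·f + (∂Ỹ/∂y)·g ), where X̃(x) = 2ε²x/(√2·ε³ − x) and Ỹ(x,y) = 2√2·ε⁵·y/(X̃(x)+2ε²)² − A₀/(X̃(x)+2ε²) are the inverse substitution formulas, the partial derivatives are evaluated at the point (x,y) above, and dt/dT = ε/√2 (so F_ε and G_ε are the chain-rule derivatives dX/dT, dY/dT along the G₂⁽¹⁾ flow). Then, as ε → 0 through nonzero values, F_ε(X,Y,T) → X⁴Y + A₀X³ + (T/2)X² + 1 and G_ε(X,Y,T) → −2X³Y² − 3A₀X²Y − TXY − A₀²X − A₀T/2, i.e. the transformed system tends to the A₂⁽²⁾ system with parameters (A₀,A₁). -/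
open Filter Topology

/-- Right-hand side of the first G₂⁽¹⁾ equation. -/
noncomputable def G2rhs1 (α₀ α₁ x y t : ℂ) : ℂ :=
  4*x^3*y + 2*(α₀+2*α₁)*x^2 + 2*t*x + 1

/-- Right-hand side of the second G₂⁽¹⁾ equation. -/
noncomputable def G2rhs2 (α₀ α₁ x y t : ℂ) : ℂ :=
  -6*x^2*y^2 - 4*(α₀+2*α₁)*x*y - 2*t*y - 2*α₁*(α₀+α₁)

/-- The denominator of the substitution `z ↦ 2ε²z/(sε³ - z)` at `sε³X/(2ε² + X)`. -/
lemma sub_substX_inv {s ε X : ℂ} (hw : 2*ε^2 + X ≠ 0) :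
    s*ε^3 - s*ε^3*X/(2*ε^2 + X) = 2*s*ε^5/(2*ε^2 + X) := by
  rw [eq_div_iff hw, sub_mul, div_mul_cancel₀ _ hw]
  ring

/-- The substitution `z ↦ 2ε²z/(sε³ - z)` takes the value `X` at `sε³X/(2ε² + X)`. -/
lemma substX_apply {s ε X : ℂ} (hs : s ≠ 0) (hε : ε ≠ 0) (hw : 2*ε^2 + X ≠ 0) :
    2*ε^2*(s*ε^3*X/(2*ε^2 + X))/(s*ε^3 - s*ε^3*X/(2*ε^2 + X)) = X := by
  rw [sub_substX_inv hw]
  field_simp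

/-- Derivative of the substitution `z ↦ 2ε²z/(sε³ - z)` at `sε³X/(2ε² + X)`. -/
lemma hasDerivAt_substX {s ε X : ℂ} (hs : s^2 = 2) (hε : ε ≠ 0) (hw : 2*ε^2 + X ≠ 0) :
    HasDerivAt (fun x' : ℂ => 2*ε^2*x'/(s*ε^3 - x')) (s*(2*ε^2 + X)^2/(4*ε^5))
      (s*ε^3*X/(2*ε^2 + X)) := by
  have hs0 : s ≠ 0 := by
    rintro rfl
    norm_num at hs
  have hd0 : s*ε^3 - s*ε^3*X/(2*ε^2 + X) ≠ 0 := by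
    rw [sub_substX_inv hw]
    exact div_ne_zero (mul_ne_zero (mul_ne_zero two_ne_zero hs0) (pow_ne_zero _ hε)) hw
  have h := ((hasDerivAt_id' (s*ε^3*X/(2*ε^2 + X))).const_mul (2*ε^2)).div
    ((hasDerivAt_id' (s*ε^3*X/(2*ε^2 + X))).const_sub (s*ε^3)) hd0
  refine h.congr_deriv ?_
  rw [sub_substX_inv hw]
  field_simp
  linear_combination (-2*(2*ε^2 + X)) * hs

/-- Partial derivative in `z` of `2sε⁵y/(X̃(z) + 2ε²)² - A/(X̃(z) + 2ε²)`. -/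
lemma hasDerivAt_substY_fst {s ε X : ℂ} (A y : ℂ) (hs : s^2 = 2) (hε : ε ≠ 0)
    (hw : 2*ε^2 + X ≠ 0) :
    HasDerivAt (fun x' : ℂ => 2*s*ε^5*y/(2*ε^2*x'/(s*ε^3 - x') + 2*ε^2)^2
        - A/(2*ε^2*x'/(s*ε^3 - x') + 2*ε^2))
      (s*A/(4*ε^5) - 2*y/(2*ε^2 + X)) (s*ε^3*X/(2*ε^2 + X)) := by
  have hs0 : s ≠ 0 := by
    rintro rfl
    norm_num at hs
  have hX := substX_apply hs0 hε hw
  have hw' : X + 2*ε^2 ≠ 0 := by rwa [add_comm]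
  have hD := (hasDerivAt_substX hs hε hw).add_const (2*ε^2)
  have h := ((hasDerivAt_const _ (2*s*ε^5*y)).div (hD.fun_pow 2)
    (by rw [hX]; exact pow_ne_zero _ hw')).sub
    ((hasDerivAt_const _ A).div hD (by rwa [hX]))
  refine h.congr_deriv ?_
  rw [hX, add_comm X]
  field_simp
  push_cast
  linear_combination (-4*ε^5*y*(2*ε^2 + X)) * hs

/-- Closed form of the first component of the transformed vector field. -/
lemma transformed_fst {s ε X : ℂ} (A Y T : ℂ) (hs : s^2 = 2) (hε : ε ≠ 0)
    (hw : 2*ε^2 + X ≠ 0) :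
    ε/s * (s*(2*ε^2 + X)^2/(4*ε^5)) *
      G2rhs1 (1/(4*ε^6)) A (s*ε^3*X/(2*ε^2 + X))
        ((X + 2*ε^2)*(X*Y + 2*ε^2*Y + A)/(2*s*ε^5)) (-(1 - ε^4*T)/(s*ε^3)) =
    X^3*((2*ε^2 + X)*Y + A) + 1 + 2*A*ε^2*X^2 + T*X*(2*ε^2 + X)/2 := by
  have hs0 : s ≠ 0 := by
    rintro rfl
    norm_num at hs
  obtain ⟨w, rfl⟩ : ∃ w, X = w - 2*ε^2 := ⟨2*ε^2 + X, by ring⟩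
  rw [add_sub_cancel] at hw
  simp only [G2rhs1, add_sub_cancel, sub_add_cancel]
  field_simp
  simp only [hs]
  ring

/-- Closed form of the second component of the transformed vector field. -/
lemma transformed_snd {s ε X : ℂ} (A Y T : ℂ) (hs : s^2 = 2) (hε : ε ≠ 0)
    (hw : 2*ε^2 + X ≠ 0) :
    ε/s * ((s*A/(4*ε^5) - 2*((X + 2*ε^2)*(X*Y + 2*ε^2*Y + A)/(2*s*ε^5))/(2*ε^2 + X)) *
        G2rhs1 (1/(4*ε^6)) A (s*ε^3*X/(2*ε^2 + X))
          ((X + 2*ε^2)*(X*Y + 2*ε^2*Y + A)/(2*s*ε^5)) (-(1 - ε^4*T)/(s*ε^3)) +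
      2*s*ε^5/(X + 2*ε^2)^2 *
        G2rhs2 (1/(4*ε^6)) A (s*ε^3*X/(2*ε^2 + X))
          ((X + 2*ε^2)*(X*Y + 2*ε^2*Y + A)/(2*s*ε^5)) (-(1 - ε^4*T)/(s*ε^3))) =
    -(2*X^3 + 3*ε^2*X^2)*Y^2 - A*X*(3*X + 4*ε^2)*Y - A^2*(X + ε^2)
      - T*(X*Y + (2*ε^2 + X)*Y + A)/2 := by
  have hs0 : s ≠ 0 := by
    rintro rfl
    norm_num at hs
  obtain ⟨w, rfl⟩ : ∃ w, X = w - 2*ε^2 := ⟨2*ε^2 + X, by ring⟩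
  rw [add_sub_cancel] at hw
  simp only [G2rhs1, G2rhs2, add_sub_cancel, sub_add_cancel]
  field_simp
  simp only [hs]
  ring

theorem degeneration_G2_to_A22 (A₀ A₁ : ℂ) (hsum : 2*A₀ + A₁ = 1)
    (X Y T : ℂ) :
    Tendsto (fun ε : ℂ =>
        let s2 : ℂ := (Real.sqrt 2 : ℝ)
        let x := s2*ε^3*X/(2*ε^2 + X)
        let y := (X + 2*ε^2)*(X*Y + 2*ε^2*Y + A₀)/(2*s2*ε^5)
        let t := -(1 - ε^4*T)/(s2*ε^3)
        let Xtil : ℂ → ℂ := fun x' => 2*ε^2*x'/(s2*ε^3 - x')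
        let f := G2rhs1 (1/(4*ε^6)) A₀ x y t
        (ε/s2) * deriv Xtil x * f)
      (𝓝[{ε : ℂ | ε ≠ 0 ∧ 2*ε^2 + X ≠ 0 ∧
        ((Real.sqrt 2 : ℝ) : ℂ)*ε^3 - ((Real.sqrt 2 : ℝ) : ℂ)*ε^3*X/(2*ε^2 + X) ≠ 0}] (0:ℂ))
      (𝓝 (X^4*Y + A₀*X^3 + (T/2)*X^2 + 1)) ∧
    Tendsto (fun ε : ℂ =>
        let s2 : ℂ := (Real.sqrt 2 : ℝ)
        let x := s2*ε^3*X/(2*ε^2 + X)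
        let y := (X + 2*ε^2)*(X*Y + 2*ε^2*Y + A₀)/(2*s2*ε^5)
        let t := -(1 - ε^4*T)/(s2*ε^3)
        let Xtil : ℂ → ℂ := fun x' => 2*ε^2*x'/(s2*ε^3 - x')
        let Ytil : ℂ → ℂ → ℂ := fun x' y' =>
          2*s2*ε^5*y'/(Xtil x' + 2*ε^2)^2 - A₀/(Xtil x' + 2*ε^2)
        let f := G2rhs1 (1/(4*ε^6)) A₀ x y t
        let g := G2rhs2 (1/(4*ε^6)) A₀ x y t
        (ε/s2) * (deriv (fun x' => Ytil x' y) x * f + deriv (fun y' => Ytil x y') y * g))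
      (𝓝[{ε : ℂ | ε ≠ 0 ∧ 2*ε^2 + X ≠ 0 ∧
        ((Real.sqrt 2 : ℝ) : ℂ)*ε^3 - ((Real.sqrt 2 : ℝ) : ℂ)*ε^3*X/(2*ε^2 + X) ≠ 0}] (0:ℂ))
      (𝓝 (-2*X^3*Y^2 - 3*A₀*X^2*Y - T*X*Y - A₀^2*X - A₀*T/2)) := by
  have hs : ((Real.sqrt 2 : ℝ) : ℂ)^2 = 2 := by
    rw [← Complex.ofReal_pow, Real.sq_sqrt zero_le_two, Complex.ofReal_ofNat]
  have hs0 : ((Real.sqrt 2 : ℝ) : ℂ) ≠ 0 := by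
    intro h
    norm_num [h] at hs
  constructor
  · have hlim : Tendsto (fun ε : ℂ => X^3*((2*ε^2 + X)*Y + A₀) + 1 + 2*A₀*ε^2*X^2
        + T*X*(2*ε^2 + X)/2) (𝓝 0) (𝓝 (X^4*Y + A₀*X^3 + (T/2)*X^2 + 1)) := by
      refine Continuous.tendsto' (by fun_prop) _ _ ?_
      ring
    refine (hlim.mono_left nhdsWithin_le_nhds).congr' ?_
    filter_upwards [self_mem_nhdsWithin] with ε ⟨hε, hw, _⟩
    dsimp only
    rw [(hasDerivAt_substX hs hε hw).deriv, transformed_fst A₀ Y T hs hε hw]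
  · have hlim : Tendsto (fun ε : ℂ => -(2*X^3 + 3*ε^2*X^2)*Y^2 - A₀*X*(3*X + 4*ε^2)*Y
        - A₀^2*(X + ε^2) - T*(X*Y + (2*ε^2 + X)*Y + A₀)/2) (𝓝 0)
        (𝓝 (-2*X^3*Y^2 - 3*A₀*X^2*Y - T*X*Y - A₀^2*X - A₀*T/2)) := by
      refine Continuous.tendsto' (by fun_prop) _ _ ?_
      ring
    refine (hlim.mono_left nhdsWithin_le_nhds).congr' ?_
    filter_upwards [self_mem_nhdsWithin] with ε ⟨hε, hw, _⟩
    dsimp only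
    have hy (y : ℂ) : HasDerivAt (fun y' : ℂ => 2*((Real.sqrt 2 : ℝ) : ℂ)*ε^5*y'/(X + 2*ε^2)^2
        - A₀/(X + 2*ε^2)) (2*((Real.sqrt 2 : ℝ) : ℂ)*ε^5/(X + 2*ε^2)^2) y := by
      simpa using (((hasDerivAt_id' y).const_mul
        (2*((Real.sqrt 2 : ℝ) : ℂ)*ε^5)).div_const ((X + 2*ε^2)^2)).sub_const (A₀/(X + 2*ε^2))
    rw [(hasDerivAt_substY_fst A₀ _ hs hε hw).deriv, substX_apply hs0 hε hw, (hy _).deriv,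
      transformed_snd A₀ Y T hs hε hw]
end

section
/- Let (x,y) be a solution of the A₂⁽²⁾ system with parameters (α₀,α₁), 2α₀+α₁ = 1, on an open set where x(t) ≠ 0. Set β₀ = α₀+α₁, β₁ = α₀. Then the functions X := 1/x and Y := −x·(xy+α₀) form a solution, in the same time variable T = t, of the A₁⁽¹⁾ system dX/dT = −X² + Y − T/2, dY/dT = 2XY + β₁ with parameters (β₀,β₁) (which satisfy β₀+β₁ = 1). -/
/-- The A₁⁽¹⁾ system. -/
def IsSolA1 (β₀ β₁ : ℂ) (U : Set ℂ) (X Y : ℂ → ℂ) : Prop :=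
  ∀ T ∈ U,
    HasDerivAt X (-(X T)^2 + Y T - T/2) T ∧
    HasDerivAt Y (2*(X T)*(Y T) + β₁) T

theorem A22_to_A1 (α₀ α₁ : ℂ) (hsum : 2*α₀ + α₁ = 1)
    (U : Set ℂ) (hU : IsOpen U)
    (x y : ℂ → ℂ) (hsol : IsSolA22 α₀ α₁ U x y)
    (hx : ∀ t ∈ U, x t ≠ 0) :
    IsSolA1 (α₀+α₁) α₀ U
      (fun t => 1/(x t))
      (fun t => -(x t) * (x t * y t + α₀)) := by
  intro t ht
  obtain ⟨hdx, hdy⟩ := hsol t ht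
  have hxt := hx t ht
  constructor
  · simp only [one_div]
    refine (hdx.fun_inv hxt).congr_deriv ?_
    field_simp
    ring
  · refine (hdx.fun_neg.fun_mul ((hdx.fun_mul hdy).add_const α₀)).congr_deriv ?_
    field_simp
    ring
end

section
/- Let (x,y,z,w) be a solution of the B₅⁽¹⁾ system with parameters (α₀,…,α₅), α₀+α₁+2α₂+2α₃+2α₄+2α₅ = 1, on an open set U of times t ≠ 0, with x(t) ≠ 0 and z(t) ≠ 0 on U. Set β₀ = α₄+2α₅, β₁ = α₄, β₂ = α₃, β₃ = α₂, β₄ = α₀, β₅ = α₁. Then the functions of T ∈ −U defined by X(T) = 1/z(−T), Y(T) = −z(−T)(z(−T)w(−T)+α₄), Z(T) = 1/x(−T), W(T) = −x(−T)(x(−T)y(−T)+α₂) form a solution of the D₅⁽¹⁾ system in the time variable T with parameters (β₀,…,β₅). -/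
/-- The B₅⁽¹⁾ system (a coupled Painlevé V system in dimension four). -/
def IsSolB5 (α₀ α₁ α₂ α₃ α₄ α₅ : ℂ) (U : Set ℂ) (x y z w : ℂ → ℂ) : Prop :=
  ∀ t ∈ U,
    HasDerivAt x (-(2*(x t)^3*(y t) - 2*(x t)^2*(y t) + (α₁+2*α₂)*(x t)^2
        + (t-1+2*α₃+2*α₄+2*α₅)*(x t) - t)/t
      - 2*((x t)-1)*(z t)*((z t)*(w t)+α₄)/t) t ∧
    HasDerivAt y ((3*(x t)^2*(y t)^2 - 2*(x t)*(y t)^2 + 2*(α₁+2*α₂)*(x t)*(y t)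
        + (t-1+2*α₃+2*α₄+2*α₅)*(y t) + α₂*(α₁+α₂))/t
      + 2*(y t)*(z t)*((z t)*(w t)+α₄)/t) t ∧
    HasDerivAt z (-(2*(z t)^3*(w t) - 2*(z t)^2*(w t) + (α₁+2*α₂+α₃+2*α₄)*(z t)^2
        + (t-1+2*α₅)*(z t) - t)/t
      - 2*((x t)-1)*(y t)*(z t)^2/t) t ∧
    HasDerivAt w ((3*(z t)^2*(w t)^2 - 2*(z t)*(w t)^2 + 2*(α₁+2*α₂+α₃+2*α₄)*(z t)*(w t)
        + (t-1+2*α₅)*(w t))/t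
      + (α₄*(α₁+2*α₂+α₃+α₄) + 2*((x t)-1)*(y t)*(2*(z t)*(w t)+α₄))/t) t

/-- The D₅⁽¹⁾ system (a coupled Painlevé V system in dimension four). -/
def IsSolD5 (β₀ β₁ β₂ β₃ β₄ β₅ : ℂ) (U : Set ℂ) (X Y Z W : ℂ → ℂ) : Prop :=
  ∀ T ∈ U,
    HasDerivAt X (2*(X T)^2*(Y T)/T + (X T)^2 - 2*(X T)*(Y T)/T
      - (1+(2*β₂+2*β₃+β₅+β₄)/T)*(X T) + (β₂+β₅)/T
      + 2*(Z T)*(((Z T)-1)*(W T)+β₃)/T) T ∧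
    HasDerivAt Y (-2*(X T)*(Y T)^2/T + (Y T)^2/T - 2*(X T)*(Y T)
      + (1+(2*β₂+2*β₃+β₅+β₄)/T)*(Y T) - β₁) T ∧
    HasDerivAt Z (2*(Z T)^2*(W T)/T + (Z T)^2 - 2*(Z T)*(W T)/T
      - (1+(β₅+β₄)/T)*(Z T) + β₅/T + 2*(Y T)*(Z T)*((Z T)-1)/T) T ∧
    HasDerivAt W (-2*(Z T)*(W T)^2/T + (W T)^2/T - 2*(Z T)*(W T)
      + (1+(β₅+β₄)/T)*(W T) - β₃ - 2*(Y T)*(-(W T)+2*(Z T)*(W T)+β₃)/T) T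

theorem B5_to_D5 (α₀ α₁ α₂ α₃ α₄ α₅ : ℂ)
    (hsum : α₀ + α₁ + 2*α₂ + 2*α₃ + 2*α₄ + 2*α₅ = 1)
    (U : Set ℂ) (hU : IsOpen U) (hU0 : ∀ t ∈ U, t ≠ 0)
    (x y z w : ℂ → ℂ) (hsol : IsSolB5 α₀ α₁ α₂ α₃ α₄ α₅ U x y z w)
    (hx : ∀ t ∈ U, x t ≠ 0) (hz : ∀ t ∈ U, z t ≠ 0) :
    IsSolD5 (α₄+2*α₅) α₄ α₃ α₂ α₀ α₁ {T : ℂ | -T ∈ U}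
      (fun T => 1/(z (-T)))
      (fun T => -(z (-T)) * ((z (-T)) * (w (-T)) + α₄))
      (fun T => 1/(x (-T)))
      (fun T => -(x (-T)) * ((x (-T)) * (y (-T)) + α₂)) := by
  intro T hT
  have hT0 : T ≠ 0 := neg_ne_zero.mp (hU0 (-T) hT)
  have hxT := hx (-T) hT
  have hzT := hz (-T) hT
  obtain ⟨dx, dy, dz, dw⟩ := hsol (-T) hT
  have reflect {f : ℂ → ℂ} {f' : ℂ} (h : HasDerivAt f f' (-T)) :
      HasDerivAt (fun S => f (-S)) (-f') T := by
    simpa [Function.comp_def] using HasDerivAt.comp T h (hasDerivAt_neg T)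
  have hα₀ : α₀ = 1 - α₁ - 2*α₂ - 2*α₃ - 2*α₄ - 2*α₅ := by linear_combination hsum
  have dx' := reflect dx
  have dy' := reflect dy
  have dz' := reflect dz
  have dw' := reflect dw
  subst hα₀
  refine ⟨?_, ?_, ?_, ?_⟩
  · refine HasDerivAt.congr_deriv ((hasDerivAt_const T (1 : ℂ)).fun_div dz' hzT) ?_
    field_simp
    ring
  · refine HasDerivAt.congr_deriv (dz'.fun_neg.fun_mul ((dz'.fun_mul dw').add_const α₄)) ?_
    field_simp
    ring
  · refine HasDerivAt.congr_deriv ((hasDerivAt_const T (1 : ℂ)).fun_div dx' hxT) ?_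
    field_simp
    ring
  · refine HasDerivAt.congr_deriv (dx'.fun_neg.fun_mul ((dx'.fun_mul dy').add_const α₂)) ?_
    field_simp
    ring
end

section
/- Let α₀,…,α₄ ∈ ℂ with α₀+α₁+α₂+α₃+α₄ = 1/2 and let (x,y,z,w) be a solution of the D₅⁽²⁾ system on an open set U of times t ≠ 0. Then each of the following transformations produces a new solution (under the stated nonvanishing hypotheses on U): s₀: the functions of s ∈ −U given by (x(−s), y(−s)−(−s), z(−s), w(−s)) form a solution in s with parameters (−α₀, α₁+2α₀, α₂, α₃, α₄); s₁: if y ≠ 0, (x+α₁/y, y, z, w) with (α₀+α₁, −α₁, α₂+α₁, α₃, α₄); s₂: if x ≠ z, (x, y−α₂/(x−z), z, w+α₂/(x−z)) with (α₀, α₁+α₂, −α₂, α₃+α₂, α₄); s₃: if w ≠ 0, (x, y, z+α₃/w, w) with (α₀, α₁, α₂+α₃, −α₃, α₄+α₃); s₄: if z ≠ 0, the functions of s ∈ −U given by (−x(−s), −y(−s), −z(−s), −w(−s)+2α₄/z(−s)−1/z(−s)²) form a solution in s with (α₀, α₁, α₂, α₃+2α₄, −α₄); π: if x ≠ 0 and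 z ≠ 0, (1/(tz), −t(zw+α₃)z, 1/(tx), −t(xy+α₁)x) is a solution (same t) with (α₄, α₃, α₂, α₁, α₀). -/
/-- The D₅⁽²⁾ system (a coupled Painlevé III system in dimension four). -/
def IsSolD52 (α₀ α₁ α₂ α₃ α₄ : ℂ) (U : Set ℂ) (x y z w : ℂ → ℂ) : Prop :=
  ∀ t ∈ U,
    HasDerivAt x (2*(x t)^2*(y t)/t - (x t)^2 - 2*(α₂+α₃+α₄)*(x t)/t + 1/t
      + 2*(z t)*((z t)*(w t)+α₃)/t) t ∧
    HasDerivAt y (-2*(x t)*(y t)^2/t + 2*(x t)*(y t) + 2*(α₂+α₃+α₄)*(y t)/t + α₁) t ∧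
    HasDerivAt z (2*(z t)^2*(w t)/t - (z t)^2 - 2*α₄*(z t)/t + 1/t
      + 2*(y t)*(z t)^2/t) t ∧
    HasDerivAt w (-2*(z t)*(w t)^2/t + 2*(z t)*(w t) + 2*α₄*(w t)/t + α₃
      - 2*(y t)*(2*(z t)*(w t)+α₃)/t) t

theorem HasDerivAt.comp_neg_arg {f : ℂ → ℂ} {d s : ℂ} (h : HasDerivAt f d (-s)) :
    HasDerivAt (fun r => f (-r)) (-d) s :=
  (h.comp s (hasDerivAt_neg s)).congr_deriv (by ring)

theorem HasDerivAt.const_div_fun {f : ℂ → ℂ} {d t : ℂ} (c : ℂ) (h : HasDerivAt f d t)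
    (h0 : f t ≠ 0) : HasDerivAt (fun r => c / f r) (-c * d / f t ^ 2) t :=
  ((hasDerivAt_const t c).div h h0).congr_deriv (by ring)

namespace IsSolD52

variable {α₀ α₁ α₂ α₃ α₄ : ℂ} {U : Set ℂ} {x y z w : ℂ → ℂ}

theorem reflection_zero (hsum : α₀ + α₁ + α₂ + α₃ + α₄ = 1/2) (hU0 : ∀ t ∈ U, t ≠ 0)
    (hsol : IsSolD52 α₀ α₁ α₂ α₃ α₄ U x y z w) :
    IsSolD52 (-α₀) (α₁+2*α₀) α₂ α₃ α₄ {s : ℂ | -s ∈ U}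
      (fun s => x (-s)) (fun s => y (-s) - (-s)) (fun s => z (-s)) (fun s => w (-s)) := by
  intro s hs
  obtain ⟨hx, hy, hz, hw⟩ := hsol (-s) hs
  have hs0 : s ≠ 0 := neg_ne_zero.mp (hU0 _ hs)
  obtain rfl : α₀ = 1/2 - α₁ - α₂ - α₃ - α₄ := by linear_combination hsum
  refine ⟨hx.comp_neg_arg.congr_deriv ?_,
    (hy.comp_neg_arg.sub (hasDerivAt_neg s)).congr_deriv ?_,
    hz.comp_neg_arg.congr_deriv ?_, hw.comp_neg_arg.congr_deriv ?_⟩ <;>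
  · field_simp
    ring

theorem reflection_one (hU0 : ∀ t ∈ U, t ≠ 0)
    (hsol : IsSolD52 α₀ α₁ α₂ α₃ α₄ U x y z w) (hy0 : ∀ t ∈ U, y t ≠ 0) :
    IsSolD52 (α₀+α₁) (-α₁) (α₂+α₁) α₃ α₄ U (fun t => x t + α₁/(y t)) y z w := by
  intro t ht
  obtain ⟨hx, hy, hz, hw⟩ := hsol t ht
  have ht0 := hU0 t ht
  have hyt := hy0 t ht
  refine ⟨(hx.add (hy.const_div_fun α₁ hyt)).congr_deriv ?_, hy.congr_deriv ?_, hz, hw⟩ <;>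
  · field_simp
    ring

theorem reflection_two (hU0 : ∀ t ∈ U, t ≠ 0)
    (hsol : IsSolD52 α₀ α₁ α₂ α₃ α₄ U x y z w) (hxz : ∀ t ∈ U, x t ≠ z t) :
    IsSolD52 α₀ (α₁+α₂) (-α₂) (α₃+α₂) α₄ U
      x (fun t => y t - α₂/(x t - z t)) z (fun t => w t + α₂/(x t - z t)) := by
  intro t ht
  obtain ⟨hx, hy, hz, hw⟩ := hsol t ht
  have ht0 := hU0 t ht
  have hd : x t - z t ≠ 0 := sub_ne_zero.mpr (hxz t ht)
  have hdiv := (hx.sub hz).const_div_fun α₂ hd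
  refine ⟨hx.congr_deriv ?_, (hy.sub hdiv).congr_deriv ?_, hz.congr_deriv ?_,
    (hw.add hdiv).congr_deriv ?_⟩ <;>
  · simp only [Pi.sub_apply]
    field_simp
    ring

theorem reflection_three (hU0 : ∀ t ∈ U, t ≠ 0)
    (hsol : IsSolD52 α₀ α₁ α₂ α₃ α₄ U x y z w) (hw0 : ∀ t ∈ U, w t ≠ 0) :
    IsSolD52 α₀ α₁ (α₂+α₃) (-α₃) (α₄+α₃) U x y (fun t => z t + α₃/(w t)) w := by
  intro t ht
  obtain ⟨hx, hy, hz, hw⟩ := hsol t ht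
  have ht0 := hU0 t ht
  have hwt := hw0 t ht
  refine ⟨hx.congr_deriv ?_, hy.congr_deriv ?_,
    (hz.add (hw.const_div_fun α₃ hwt)).congr_deriv ?_, hw.congr_deriv ?_⟩ <;>
  · field_simp
    ring

theorem reflection_four (hU0 : ∀ t ∈ U, t ≠ 0)
    (hsol : IsSolD52 α₀ α₁ α₂ α₃ α₄ U x y z w) (hz0 : ∀ t ∈ U, z t ≠ 0) :
    IsSolD52 α₀ α₁ α₂ (α₃+2*α₄) (-α₄) {s : ℂ | -s ∈ U}
      (fun s => -x (-s)) (fun s => -y (-s)) (fun s => -z (-s))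
      (fun s => -w (-s) + 2*α₄/(z (-s)) - 1/(z (-s))^2) := by
  intro s hs
  obtain ⟨hx, hy, hz, hw⟩ := hsol (-s) hs
  have hs0 : s ≠ 0 := neg_ne_zero.mp (hU0 _ hs)
  have hzs := hz0 _ hs
  have hdiv := hz.comp_neg_arg.const_div_fun (2*α₄) hzs
  have hdiv_sq := (hz.comp_neg_arg.pow 2).const_div_fun 1 (pow_ne_zero 2 hzs)
  refine ⟨hx.comp_neg_arg.neg.congr_deriv ?_, hy.comp_neg_arg.neg.congr_deriv ?_,
    hz.comp_neg_arg.neg.congr_deriv ?_,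
    ((hw.comp_neg_arg.neg.add hdiv).sub hdiv_sq).congr_deriv ?_⟩ <;>
  · simp only [Pi.pow_apply, Nat.cast_ofNat]
    field_simp
    ring

theorem diagram_automorphism (hsum : α₀ + α₁ + α₂ + α₃ + α₄ = 1/2) (hU0 : ∀ t ∈ U, t ≠ 0)
    (hsol : IsSolD52 α₀ α₁ α₂ α₃ α₄ U x y z w)
    (hx0 : ∀ t ∈ U, x t ≠ 0) (hz0 : ∀ t ∈ U, z t ≠ 0) :
    IsSolD52 α₄ α₃ α₂ α₁ α₀ U
      (fun t => 1/(t * z t))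
      (fun t => -t * (z t * w t + α₃) * z t)
      (fun t => 1/(t * x t))
      (fun t => -t * (x t * y t + α₁) * x t) := by
  intro t ht
  obtain ⟨hx, hy, hz, hw⟩ := hsol t ht
  have ht0 := hU0 t ht
  have hxt := hx0 t ht
  have hzt := hz0 t ht
  obtain rfl : α₀ = 1/2 - α₁ - α₂ - α₃ - α₄ := by linear_combination hsum
  have hid := hasDerivAt_id' t
  refine ⟨((hid.mul hz).const_div_fun 1 (mul_ne_zero ht0 hzt)).congr_deriv ?_,
    ((hid.neg.mul ((hz.mul hw).add_const α₃)).mul hz).congr_deriv ?_,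
    ((hid.mul hx).const_div_fun 1 (mul_ne_zero ht0 hxt)).congr_deriv ?_,
    ((hid.neg.mul ((hx.mul hy).add_const α₁)).mul hx).congr_deriv ?_⟩ <;>
  · simp only [Pi.mul_apply, Pi.neg_apply]
    field_simp
    ring

end IsSolD52

theorem backlund_D52 (α₀ α₁ α₂ α₃ α₄ : ℂ)
    (hsum : α₀ + α₁ + α₂ + α₃ + α₄ = 1/2)
    (U : Set ℂ) (hU : IsOpen U) (hU0 : ∀ t ∈ U, t ≠ 0)
    (x y z w : ℂ → ℂ) (hsol : IsSolD52 α₀ α₁ α₂ α₃ α₄ U x y z w) :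
    IsSolD52 (-α₀) (α₁+2*α₀) α₂ α₃ α₄ {s : ℂ | -s ∈ U}
      (fun s => x (-s)) (fun s => y (-s) - (-s)) (fun s => z (-s)) (fun s => w (-s)) ∧
    ((∀ t ∈ U, y t ≠ 0) →
      IsSolD52 (α₀+α₁) (-α₁) (α₂+α₁) α₃ α₄ U
        (fun t => x t + α₁/(y t)) y z w) ∧
    ((∀ t ∈ U, x t ≠ z t) →
      IsSolD52 α₀ (α₁+α₂) (-α₂) (α₃+α₂) α₄ U
        x (fun t => y t - α₂/(x t - z t)) z (fun t => w t + α₂/(x t - z t))) ∧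
    ((∀ t ∈ U, w t ≠ 0) →
      IsSolD52 α₀ α₁ (α₂+α₃) (-α₃) (α₄+α₃) U
        x y (fun t => z t + α₃/(w t)) w) ∧
    ((∀ t ∈ U, z t ≠ 0) →
      IsSolD52 α₀ α₁ α₂ (α₃+2*α₄) (-α₄) {s : ℂ | -s ∈ U}
        (fun s => -x (-s)) (fun s => -y (-s)) (fun s => -z (-s))
        (fun s => -w (-s) + 2*α₄/(z (-s)) - 1/(z (-s))^2)) ∧
    ((∀ t ∈ U, x t ≠ 0) → (∀ t ∈ U, z t ≠ 0) →
      IsSolD52 α₄ α₃ α₂ α₁ α₀ U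
        (fun t => 1/(t * z t))
        (fun t => -t * (z t * w t + α₃) * z t)
        (fun t => 1/(t * x t))
        (fun t => -t * (x t * y t + α₁) * x t)) := by
  exact ⟨hsol.reflection_zero hsum hU0, hsol.reflection_one hU0, hsol.reflection_two hU0,
    hsol.reflection_three hU0, hsol.reflection_four hU0, hsol.diagram_automorphism hsum hU0⟩
end

section
/- Let (x,y,z,w) be a solution of the D₅⁽²⁾ system with parameters (α₀,…,α₄), α₀+α₁+α₂+α₃+α₄ = 1/2, on an open set of times t ≠ 0 with x(t) ≠ 0 and z(t) ≠ 0. Set β₀ = α₃+2α₄, β₁ = α₃, β₂ = α₂, β₃ = α₁, β₄ = α₀. Then the functions X := 1/z, Y := −z(zw+α₃), Z := 1/x, W := −x(xy+α₁) form a solution, in the same time variable T = t, of the B₄⁽¹⁾ system with parameters (β₀,…,β₄) (which satisfy β₀+β₁+2β₂+2β₃+2β₄ = 1). -/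
/-- The B₄⁽¹⁾ system (a coupled Painlevé III system in dimension four). -/
def IsSolB4 (β₀ β₁ β₂ β₃ β₄ : ℂ) (U : Set ℂ) (X Y Z W : ℂ → ℂ) : Prop :=
  ∀ T ∈ U,
    HasDerivAt X ((2*(X T)^2*(Y T) - (X T)^2 + (β₀+β₁)*(X T) + 2*β₃*(Z T)
      + 2*(Z T)^2*(W T))/T + 1) T ∧
    HasDerivAt Y ((-2*(X T)*(Y T)^2 + 2*(X T)*(Y T) - (β₀+β₁)*(Y T) + β₁)/T) T ∧
    HasDerivAt Z ((2*(Z T)^2*(W T) - (Z T)^2 + (1-2*β₄)*(Z T) + 2*(Y T)*(Z T)^2)/T + 1) T ∧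
    HasDerivAt W ((-2*(Z T)*(W T)^2 + 2*(Z T)*(W T) - (1-2*β₄)*(W T) - 2*β₃*(Y T)
      - 4*(Y T)*(Z T)*(W T) + β₃)/T) T

theorem D52_to_B4 (α₀ α₁ α₂ α₃ α₄ : ℂ)
    (hsum : α₀ + α₁ + α₂ + α₃ + α₄ = 1/2)
    (U : Set ℂ) (hU : IsOpen U) (hU0 : ∀ t ∈ U, t ≠ 0)
    (x y z w : ℂ → ℂ) (hsol : IsSolD52 α₀ α₁ α₂ α₃ α₄ U x y z w)
    (hx : ∀ t ∈ U, x t ≠ 0) (hz : ∀ t ∈ U, z t ≠ 0) :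
    IsSolB4 (α₃+2*α₄) α₃ α₂ α₁ α₀ U
      (fun t => 1/(z t))
      (fun t => -(z t) * (z t * w t + α₃))
      (fun t => 1/(x t))
      (fun t => -(x t) * (x t * y t + α₁)) := by
  intro t ht
  obtain ⟨dx, dy, dz, dw⟩ := hsol t ht
  have ht0 := hU0 t ht
  have hx0 := hx t ht
  have hz0 := hz t ht
  obtain rfl : α₀ = 1/2 - α₁ - α₂ - α₃ - α₄ := by linear_combination hsum
  refine ⟨?_, ?_, ?_, ?_⟩
  · refine ((hasDerivAt_const t (1 : ℂ)).fun_div dz hz0).congr_deriv ?_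
    field_simp
    ring
  · refine (dz.fun_neg.fun_mul ((dz.fun_mul dw).add_const α₃)).congr_deriv ?_
    field_simp
    ring
  · refine ((hasDerivAt_const t (1 : ℂ)).fun_div dx hx0).congr_deriv ?_
    field_simp
    ring
  · refine (dx.fun_neg.fun_mul ((dx.fun_mul dy).add_const α₁)).congr_deriv ?_
    field_simp
    ring
end
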